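/- The number of commutation classes of reduced expressions of the longest element of S_5 is exactly 62; that is, the quotient of the set of reduced expressions for the permutation [5,4,3,2,1] by commutation equivalence has cardinality 62. -/

import Mathlib

/-- The adjacent transposition `sᵢ = (i, i+1)` (1-indexed) acting on `Fin n`
(0-indexed positions `i-1` and `i`), defined for letters `1 ≤ i ≤ n-1`. -/
def adjTransp (n : ℕ) (i : ℕ) : Equiv.Perm (Fin n) :=
  if h : 1 ≤ i ∧ i < n then
    Equiv.swap ⟨i - 1, lt_of_le_of_lt (Nat.pred_le i) h.2⟩ ⟨i, h.2⟩
  else 1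

/-- The product `s_{i₁} ⋯ s_{i_m}` of the word `w = (i₁, …, i_m)`. -/
def wordProd (n : ℕ) (w : List ℕ) : Equiv.Perm (Fin n) :=
  (w.map (adjTransp n)).prod

/-- A word is a finite sequence of letters from `{1, …, n-1}`. -/
def IsWord (n : ℕ) (w : List ℕ) : Prop := ∀ i ∈ w, 1 ≤ i ∧ i ≤ n - 1

/-- A word is an expression for a permutation `p` if its product equals `p`. -/
def IsExpression (n : ℕ) (p : Equiv.Perm (Fin n)) (w : List ℕ) : Prop :=
  IsWord n w ∧ wordProd n w = p

/-- A reduced expression has minimal length among all expressions for `p`. -/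
def IsReducedExpr (n : ℕ) (p : Equiv.Perm (Fin n)) (w : List ℕ) : Prop :=
  IsExpression n p w ∧ ∀ w' : List ℕ, IsExpression n p w' → w.length ≤ w'.length

/-- The Coxeter length of `p`: minimal length of an expression for `p`. -/
noncomputable def coxLength (n : ℕ) (p : Equiv.Perm (Fin n)) : ℕ :=
  sInf {m | ∃ w : List ℕ, IsExpression n p w ∧ w.length = m}

/-- The longest element `w₀ : j ↦ n + 1 - j` (1-indexed), i.e. `Fin.rev` on `Fin n`. -/
def longestElem (n : ℕ) : Equiv.Perm (Fin n) := Fin.revPerm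
/-- A single commutation: swap two consecutive letters at distance ≥ 2. -/
def CommutationMove (u v : List ℕ) : Prop :=
  ∃ (x y : List ℕ) (a b : ℕ), 2 ≤ Nat.dist a b ∧
    u = x ++ [a, b] ++ y ∧ v = x ++ [b, a] ++ y

open Relation

namespace CommutationClass

/-- The subword of `w` formed by its letters `i` and `i + 1`. -/
def proj (i : ℕ) (w : List ℕ) : List ℕ := w.filter fun x => x == i || x == i + 1

lemma proj_append (i : ℕ) (u v : List ℕ) : proj i (u ++ v) = proj i u ++ proj i v :=
  List.filter_append ..

lemma proj_cons (i a : ℕ) (w : List ℕ) :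
    proj i (a :: w) = proj i [a] ++ proj i w := proj_append i [a] w

lemma mem_proj {i c : ℕ} {w : List ℕ} : c ∈ proj i w ↔ c ∈ w ∧ (c = i ∨ c = i + 1) := by
  simp [proj]

lemma proj_eq_of_commutationMove {u v : List ℕ} (h : CommutationMove u v) (i : ℕ) :
    proj i u = proj i v := by
  obtain ⟨x, y, a, b, hab, rfl, rfl⟩ := h
  simp only [proj_append]
  congr 2
  unfold Nat.dist at hab
  by_cases ha : a = i ∨ a = i + 1 <;> by_cases hb : b = i ∨ b = i + 1
  · omega
  all_goals simp [proj, ha, hb]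

lemma commutationMove_cons {u v : List ℕ} (a : ℕ) (h : CommutationMove u v) :
    CommutationMove (a :: u) (a :: v) := by
  obtain ⟨x, y, b, c, hbc, rfl, rfl⟩ := h
  exact ⟨a :: x, y, b, c, hbc, rfl, rfl⟩

lemma reflTransGen_cons {u v : List ℕ} (a : ℕ) (h : ReflTransGen CommutationMove u v) :
    ReflTransGen CommutationMove (a :: u) (a :: v) :=
  ReflTransGen.lift (a :: ·) (fun _ _ => commutationMove_cons a) _ _ h

lemma reflTransGen_cons_append (a : ℕ) (x y : List ℕ) (h : ∀ c ∈ x, 2 ≤ Nat.dist a c) :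
    ReflTransGen CommutationMove (a :: (x ++ y)) (x ++ a :: y) := by
  induction x with
  | nil => exact .refl
  | cons c x ih =>
    refine .head ⟨[], x ++ y, a, c, h c (by simp), rfl, rfl⟩ ?_
    exact reflTransGen_cons c (ih fun d hd => h d (by simp [hd]))

/-- Words with the same projections are related by commutations. -/
lemma reflTransGen_of_proj_eq (u v : List ℕ) (h : ∀ i, proj i u = proj i v) :
    ReflTransGen CommutationMove u v := by
  induction u generalizing v with
  | nil =>
    obtain rfl : v = [] := List.eq_nil_iff_forall_not_mem.2 fun a ha => by
      have : a ∈ proj a v := mem_proj.2 ⟨ha, .inl rfl⟩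
      rw [← h a] at this
      simp [proj] at this
    exact .refl
  | cons a u ih =>
    have hav : a ∈ v := by
      have : a ∈ proj a (a :: u) := mem_proj.2 ⟨by simp, .inl rfl⟩
      exact (mem_proj.1 (h a ▸ this)).1
    obtain ⟨x, y, rfl, hax⟩ := List.eq_append_cons_of_mem hav
    have proj_nil (i : ℕ) (hi : a = i ∨ a = i + 1) : proj i x = [] := by
      have hi' := h i
      rw [proj_cons, proj_append] at hi'
      cases hx : proj i x with
      | nil => rfl
      | cons d l =>
        obtain rfl : a = d := by
          rw [hx] at hi'
          simpa [proj, hi] using congrArg List.head? hi'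
        exact absurd (mem_proj.1 (hx ▸ List.mem_cons_self : a ∈ proj i x)).1 hax
    have hx : ∀ c ∈ x, 2 ≤ Nat.dist a c := by
      intro c hc
      by_contra hlt
      unfold Nat.dist at hlt
      have hm : c ∈ proj (min a c) x := mem_proj.2 ⟨hc, by omega⟩
      rw [proj_nil _ (by omega)] at hm
      simp at hm
    refine (reflTransGen_cons a (ih (x ++ y) fun i => ?_)).trans
      (reflTransGen_cons_append a x y hx)
    have hi := h i
    rw [proj_cons, proj_append, proj_cons i a y] at hi
    rw [proj_append]
    by_cases ha : a = i ∨ a = i + 1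
    · rw [proj_nil i ha] at hi ⊢
      simpa using hi
    · simpa [proj, ha] using hi

lemma adjTransp_mul_comm (n : ℕ) {a b : ℕ} (h : 2 ≤ Nat.dist a b) :
    adjTransp n a * adjTransp n b = adjTransp n b * adjTransp n a := by
  unfold adjTransp
  unfold Nat.dist at h
  split_ifs
  · refine (Equiv.Perm.disjoint_swap_swap ?_).commute
    simp [Fin.ext_iff]
    omega
  all_goals simp

lemma isReducedExpr_of_commutationMove {n : ℕ} {p : Equiv.Perm (Fin n)} {u v : List ℕ}
    (h : CommutationMove u v) (hu : IsReducedExpr n p u) : IsReducedExpr n p v := by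
  obtain ⟨x, y, a, b, hab, rfl, rfl⟩ := h
  obtain ⟨⟨hw, hp⟩, hmin⟩ := hu
  refine ⟨⟨fun i hi => hw i ?_, ?_⟩, fun w hw => ?_⟩
  · simp only [List.mem_append, List.mem_cons] at hi ⊢
    tauto
  · rw [← hp]
    simp [wordProd, mul_assoc, ← mul_assoc (adjTransp n a), adjTransp_mul_comm n hab]
  · simpa using hmin w hw

lemma quot_mk_eq_of_reflTransGen {n : ℕ} {p : Equiv.Perm (Fin n)} {u v : List ℕ}
    (h : ReflTransGen CommutationMove u v) (hu : IsReducedExpr n p u)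
    (hv : IsReducedExpr n p v) :
    Quot.mk (fun u v : {w : List ℕ // IsReducedExpr n p w} => CommutationMove u.1 v.1) ⟨u, hu⟩ =
      Quot.mk _ ⟨v, hv⟩ := by
  induction h using ReflTransGen.head_induction_on with
  | refl => rfl
  | head hm _ ih =>
    have hc := isReducedExpr_of_commutationMove hm hu
    refine Eq.trans (Quot.sound ?_) (ih hc)
    exact hm

/-- The projections of a word to the pairs of adjacent letters of `{0, …, n}`. -/
def signature (n : ℕ) (w : List ℕ) : List (List ℕ) := (List.range n).map (proj · w)

lemma signature_eq_of_commutationMove (n : ℕ) {u v : List ℕ} (h : CommutationMove u v) :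
    signature n u = signature n v := by
  simp only [signature, proj_eq_of_commutationMove h]

lemma proj_eq_of_signature_eq {n : ℕ} {u v : List ℕ} (hu : IsWord n u) (hv : IsWord n v)
    (h : signature n u = signature n v) (i : ℕ) : proj i u = proj i v := by
  by_cases hi : i < n
  · exact List.map_inj_left.1 h i (List.mem_range.2 hi)
  · have key (w : List ℕ) (hw : IsWord n w) : proj i w = [] := by
      refine List.eq_nil_iff_forall_not_mem.2 fun c hc => ?_
      obtain ⟨hc, _⟩ := mem_proj.1 hc
      have := hw c hc
      omega
    rw [key u hu, key v hv]

/-- Commutation classes are counted by the signatures of reduced expressions. -/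
lemma card_quot_eq_ncard_signature (n : ℕ) (p : Equiv.Perm (Fin n)) :
    Nat.card (Quot fun u v : {w : List ℕ // IsReducedExpr n p w} => CommutationMove u.1 v.1) =
      (signature n '' {w | IsReducedExpr n p w}).ncard := by
  let f : (Quot fun u v : {w : List ℕ // IsReducedExpr n p w} => CommutationMove u.1 v.1) →
      List (List ℕ) :=
    Quot.lift (fun w => signature n w.1) fun _ _ h => signature_eq_of_commutationMove n h
  have hf : Function.Injective f := by
    rintro ⟨u, hu⟩ ⟨v, hv⟩ h
    exact quot_mk_eq_of_reflTransGen
      (reflTransGen_of_proj_eq u v (proj_eq_of_signature_eq hu.1.1 hv.1.1 h)) hu hv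
  rw [← Nat.card_range_of_injective hf, Nat.card_coe_set_eq]
  congr 1
  ext s
  constructor
  · rintro ⟨⟨w, hw⟩, rfl⟩
    exact ⟨w, hw, rfl⟩
  · rintro ⟨w, hw, rfl⟩
    exact ⟨Quot.mk _ ⟨w, hw⟩, rfl⟩

/-- The one-line notation of the inverse of a permutation. -/
def inverseList (p : Equiv.Perm (Fin 5)) : List ℕ := List.ofFn fun j => (p⁻¹ j : ℕ)

/-- Swap the entries of a list at the positions `i` and `i + 1`. -/
def swapAt : ℕ → List ℕ → List ℕ
  | 0, a :: b :: l => b :: a :: l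
  | i + 1, a :: l => a :: swapAt i l
  | _, l => l

/-- Whether a list has a descent at position `i`. -/
def hasDescent : ℕ → List ℕ → Bool
  | 0, a :: b :: _ => Nat.blt b a
  | i + 1, _ :: l => hasDescent i l
  | _, _ => false

/-- The number of inversions of a list. -/
def inversions : List ℕ → ℕ
  | [] => 0
  | a :: l => l.countP (fun b => Nat.blt b a) + inversions l

lemma swapAt_perm (i : ℕ) (l : List ℕ) : (swapAt i l).Perm l := by
  fun_induction swapAt i l with
  | case1 a b l => exact .swap a b l
  | case2 i a l ih => exact ih.cons a
  | case3 => exact .refl _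

lemma inversions_swapAt {i : ℕ} {l : List ℕ} (hl : l.Nodup) (hi : i + 1 < l.length) :
    inversions (swapAt i l) + (if hasDescent i l then 1 else 0) =
      inversions l + (if hasDescent i l then 0 else 1) := by
  fun_induction swapAt i l with
  | case1 a b l =>
    have hab : a ≠ b := by
      rintro rfl
      simp at hl
    by_cases h : b < a
    · have h' : ¬ a < b := by omega
      simp [inversions, hasDescent, Nat.blt_eq, h, h']
      omega
    · have h' : a < b := by omega
      simp [inversions, hasDescent, Nat.blt_eq, h, h']
      omega
  | case2 i a l ih =>
    have := ih (List.nodup_cons.1 hl).2 (by simpa using hi)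
    have hd : hasDescent (i + 1) (a :: l) = hasDescent i l := rfl
    rw [hd]
    simp only [inversions, (swapAt_perm i l).countP_eq]
    omega
  | case3 i l h0 h1 =>
    match i, l, hi with
    | 0, a :: b :: l, _ => exact (h0 a b l rfl rfl).elim
    | i + 1, a :: l, _ => exact (h1 i a l rfl rfl).elim

lemma inverseList_injective : Function.Injective inverseList := by
  intro p q h
  rw [← inv_inj]
  ext j
  exact congrFun (List.ofFn_injective h) j

lemma nodup_inverseList (p : Equiv.Perm (Fin 5)) : (inverseList p).Nodup :=
  List.nodup_ofFn_ofInjective (Fin.val_injective.comp p⁻¹.injective)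

lemma inverseList_adjTransp_mul {i : ℕ} (hi : 1 ≤ i ∧ i ≤ 4) (p : Equiv.Perm (Fin 5)) :
    inverseList (adjTransp 5 i * p) = swapAt (i - 1) (inverseList p) := by
  obtain ⟨h1, h4⟩ := hi
  interval_cases i <;> rfl

lemma inversions_inverseList_adjTransp_mul {i : ℕ} (hi : 1 ≤ i ∧ i ≤ 4)
    (p : Equiv.Perm (Fin 5)) :
    inversions (inverseList (adjTransp 5 i * p)) +
        (if hasDescent (i - 1) (inverseList p) then 1 else 0) =
      inversions (inverseList p) + (if hasDescent (i - 1) (inverseList p) then 0 else 1) := by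
  rw [inverseList_adjTransp_mul hi]
  refine inversions_swapAt (nodup_inverseList p) ?_
  simp only [inverseList, List.length_ofFn]
  omega

lemma adjTransp_mul_self (n i : ℕ) : adjTransp n i * adjTransp n i = 1 := by
  unfold adjTransp
  split_ifs <;> simp

lemma adjTransp_mul_cancel_left (n i : ℕ) (p : Equiv.Perm (Fin n)) :
    adjTransp n i * (adjTransp n i * p) = p := by
  rw [← mul_assoc, adjTransp_mul_self, one_mul]

lemma mem_letters {i : ℕ} : i ∈ [1, 2, 3, 4] ↔ 1 ≤ i ∧ i ≤ 4 := by
  simp only [List.mem_cons, List.not_mem_nil, or_false]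
  omega

lemma wordProd_cons (n i : ℕ) (w : List ℕ) :
    wordProd n (i :: w) = adjTransp n i * wordProd n w := by simp [wordProd]

lemma isWord_cons {n i : ℕ} {w : List ℕ} :
    IsWord n (i :: w) ↔ (1 ≤ i ∧ i ≤ n - 1) ∧ IsWord n w := by simp [IsWord]

lemma inversions_wordProd_le {w : List ℕ} (hw : IsWord 5 w) :
    inversions (inverseList (wordProd 5 w)) ≤ w.length := by
  induction w with
  | nil => decide
  | cons i w ih =>
    obtain ⟨hi, hw⟩ := isWord_cons.1 hw
    have h := inversions_inverseList_adjTransp_mul hi (wordProd 5 w)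
    have := ih hw
    rw [wordProd_cons, List.length_cons]
    split_ifs at h <;> omega

/-- The words of length `k` that express the permutation whose inverse has one-line notation `l`
and whose letters all remove an inversion. -/
def expressions : ℕ → List ℕ → List (List ℕ)
  | 0, l => if l = [0, 1, 2, 3, 4] then [[]] else []
  | k + 1, l => [1, 2, 3, 4].flatMap fun i =>
      if hasDescent (i - 1) l then (expressions k (swapAt (i - 1) l)).map (i :: ·) else []

lemma isExpression_of_mem_expressions {k : ℕ} {p : Equiv.Perm (Fin 5)} {w : List ℕ}
    (h : w ∈ expressions k (inverseList p)) : IsExpression 5 p w ∧ w.length = k := by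
  induction k generalizing p w with
  | zero =>
    rw [expressions] at h
    split_ifs at h with hp
    · obtain rfl : w = [] := by simpa using h
      obtain rfl : p = 1 := inverseList_injective (hp.trans (by decide))
      exact ⟨⟨by simp [IsWord], rfl⟩, rfl⟩
    · simp at h
  | succ k ih =>
    simp only [expressions, List.mem_flatMap, mem_letters] at h
    obtain ⟨i, hi, h⟩ := h
    split_ifs at h
    · obtain ⟨w, hw, rfl⟩ := List.mem_map.1 h
      rw [← inverseList_adjTransp_mul hi] at hw
      obtain ⟨⟨hw, hp⟩, hk⟩ := ih hw
      exact ⟨⟨isWord_cons.2 ⟨hi, hw⟩, by rw [wordProd_cons, hp, adjTransp_mul_cancel_left]⟩,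
        by simp [hk]⟩
    · simp at h

lemma mem_expressions_wordProd {w : List ℕ} (hw : IsWord 5 w)
    (h : w.length = inversions (inverseList (wordProd 5 w))) :
    w ∈ expressions w.length (inverseList (wordProd 5 w)) := by
  induction w with
  | nil => decide
  | cons i w ih =>
    obtain ⟨hi, hw⟩ := isWord_cons.1 hw
    have hstep := inversions_inverseList_adjTransp_mul hi (wordProd 5 (i :: w))
    rw [wordProd_cons, adjTransp_mul_cancel_left, ← wordProd_cons] at hstep
    have hle := inversions_wordProd_le hw
    rw [List.length_cons] at h ⊢
    simp only [expressions, List.mem_flatMap, mem_letters]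
    refine ⟨i, hi, ?_⟩
    split_ifs at hstep ⊢ with hd
    · refine List.mem_map.2 ⟨w, ?_, rfl⟩
      rw [← inverseList_adjTransp_mul hi, wordProd_cons, adjTransp_mul_cancel_left]
      exact ih hw (by omega)
    · omega

lemma inverseList_longestElem : inverseList (longestElem 5) = [4, 3, 2, 1, 0] := by decide

lemma isReducedExpr_longestElem_iff {w : List ℕ} :
    IsReducedExpr 5 (longestElem 5) w ↔ w ∈ expressions 10 [4, 3, 2, 1, 0] := by
  have hinv : inversions (inverseList (longestElem 5)) = 10 := by
    rw [inverseList_longestElem]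
    rfl
  have lower (w : List ℕ) (hw : IsExpression 5 (longestElem 5) w) : 10 ≤ w.length := by
    simpa [hw.2, hinv] using inversions_wordProd_le hw.1
  rw [← inverseList_longestElem]
  constructor
  · rintro ⟨hw, hmin⟩
    have hlen : w.length = 10 := by
      refine le_antisymm (hmin [1, 2, 1, 3, 2, 1, 4, 3, 2, 1] ⟨by simp [IsWord], ?_⟩) (lower w hw)
      apply inverseList_injective
      decide +kernel
    have := mem_expressions_wordProd hw.1 (by rw [hw.2, hlen, hinv])
    rwa [hw.2, hlen] at this
  · intro h
    obtain ⟨hw, hlen⟩ := isExpression_of_mem_expressions h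
    exact ⟨hw, fun v hv => hlen ▸ lower v hv⟩

lemma length_dedup_signature_expressions :
    ((expressions 10 [4, 3, 2, 1, 0]).map (signature 5)).dedup.length = 62 := by
  decide +kernel

end CommutationClass

open CommutationClass

/-- The number of commutation classes of reduced expressions of the longest
element of S_5 is exactly 62. -/
theorem card_commClasses_S5 :
    Nat.card (Quot fun u v : {w : List ℕ // IsReducedExpr 5 (longestElem 5) w} =>
      CommutationMove u.1 v.1) = 62 := by
  rw [card_quot_eq_ncard_signature]
  have h : signature 5 '' {w | IsReducedExpr 5 (longestElem 5) w} =
      (((expressions 10 [4, 3, 2, 1, 0]).map (signature 5)).toFinset : Set _) := by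
    ext s
    simp [isReducedExpr_longestElem_iff]
  rw [h, Set.ncard_coe_finset, List.card_toFinset, length_dedup_signature_expressions]
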